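/- arXiv:2303.03191 — 10 statements merged into one kernel-verified Lean document; each statement's English description precedes it below -/
import Mathlib

section
/- Let V be a real vector space with dim V = 3, let μ be a nonzero alternating 3-form on V, let B ∈ V, and let η be a linear functional on V with η(B) > 0. Then the linear map b : V → V* defined by (b v)(w) = μ(B, v, w) + η(v)·η(w) is bijective (a linear equivalence between V and its dual). -/
/-- Let `V` be a real vector space with `dim V = 3`, let `μ` be a nonzero
alternating 3-form on `V`, let `B ∈ V`, and let `η` be a linear functional on `V` with
`η B > 0`. Then the linear map `b : V → V*` defined by `(b v) w = μ (B, v, w) + η v * η w`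
is bijective. -/
theorem stmt_0 (V : Type*) [AddCommGroup V] [Module ℝ V] [FiniteDimensional ℝ V]
    (hdim : Module.finrank ℝ V = 3)
    (μ : V [⋀^Fin 3]→ₗ[ℝ] ℝ) (hμ : μ ≠ 0) (B : V) (η : V →ₗ[ℝ] ℝ) (hη : 0 < η B)
    (b : V →ₗ[ℝ] (V →ₗ[ℝ] ℝ))
    (hb : ∀ v w : V, b v w = μ ![B, v, w] + η v * η w) :
    Function.Bijective b := by
  have hinj : Function.Injective b := by
    rw [injective_iff_map_eq_zero]
    intro v hv
    have h1 : ∀ w, μ ![B, v, w] + η v * η w = 0 := by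
      intro w
      rw [← hb, hv]; rfl
    have h2 : μ ![B, v, B] = 0 :=
      μ.map_eq_zero_of_eq ![B, v, B] (i := 0) (j := 2) rfl (by decide)
    have h3 : η v = 0 := by
      have h := h1 B
      rw [h2, zero_add] at h
      exact (mul_eq_zero.mp h).resolve_right hη.ne'
    by_contra hv0
    have hli : LinearIndependent ℝ ![B, v] := by
      rw [LinearIndependent.pair_iff]
      intro s t hst
      have hs : s = 0 := by
        have h := congrArg η hst
        simp only [map_add, map_smul, h3, smul_eq_mul, mul_zero, add_zero, map_zero] at h
        exact (mul_eq_zero.mp h).resolve_right hη.ne'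
      subst hs
      rw [zero_smul, zero_add] at hst
      exact ⟨rfl, (smul_eq_zero.mp hst).resolve_right hv0⟩
    obtain ⟨w, hw⟩ := exists_linearIndependent_snoc_of_lt_finrank hli (by omega)
    have he : (Fin.snoc ![B, v] w : Fin 3 → V) = ![B, v, w] := by
      ext i; fin_cases i <;> rfl
    have hw' : LinearIndependent ℝ ![B, v, w] := he ▸ hw
    let e := basisOfLinearIndependentOfCardEqFinrank hw' (by simp [hdim])
    have hee : ⇑e = ![B, v, w] := coe_basisOfLinearIndependentOfCardEqFinrank hw' _
    apply hμ
    rw [← AlternatingMap.map_basis_eq_zero_iff e, hee]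
    simpa [h3] using h1 w
  refine ⟨hinj, ?_⟩
  exact (LinearMap.injective_iff_surjective_of_finrank_eq_finrank
    (Subspace.dual_finrank_eq (K := ℝ) (V := V)).symm).mp hinj
end

section
/- Let V be a real vector space with dim V = 3, let μ be a nonzero alternating 3-form on V, let B ∈ V, and let η be a linear functional on V with η(B) > 0. Define b : V → V* by (b v)(w) = μ(B, v, w) + η(v)·η(w). Then for every v ∈ V and every linear functional α on V, one has b v = α if and only if for all w₁, w₂ ∈ V: μ(v, w₁, w₂) = (α(w₁)·η(w₂) − η(w₁)·α(w₂))/η(B) + (α(B)/η(B)²)·μ(B, w₁, w₂). -/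
theorem four_id (V : Type*) [AddCommGroup V] [Module ℝ V] [FiniteDimensional ℝ V]
    (hdim : Module.finrank ℝ V = 3)
    (μ : V [⋀^Fin 3]→ₗ[ℝ] ℝ) (η : V →ₗ[ℝ] ℝ) (B v x y : V) :
    η B * μ ![v, x, y] =
      η v * μ ![B, x, y] - η x * μ ![B, v, y] + η y * μ ![B, v, x] := by
  let e := Module.finBasisOfFinrankEq ℝ V hdim
  have hm : ∀ p q r : V, μ ![p, q, r] = μ e * e.det ![p, q, r] := by
    intro p q r
    conv_lhs => rw [AlternatingMap.eq_smul_basis_det e μ]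
    simp
  have he : ∀ p : V, η p = e.repr p 0 * η (e 0) + e.repr p 1 * η (e 1)
      + e.repr p 2 * η (e 2) := by
    intro p
    conv_lhs => rw [← e.sum_repr p]
    simp only [Fin.sum_univ_three, map_add, map_smul, smul_eq_mul]
  simp only [hm, he B, he v, he x, he y, Module.Basis.det_apply, Matrix.det_fin_three,
    Module.Basis.toMatrix_apply]
  simp
  ring

/-- With `V`, `μ`, `B`, `η` as before and `b v w = μ (B, v, w) + η v * η w`,
for every `v ∈ V` and every linear functional `α` on `V`, `b v = α` iff for all `w₁ w₂`:
`μ (v, w₁, w₂) = (α w₁ * η w₂ − η w₁ * α w₂) / η B + (α B / (η B)^2) * μ (B, w₁, w₂)`. -/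
theorem stmt_1 (V : Type*) [AddCommGroup V] [Module ℝ V] [FiniteDimensional ℝ V]
    (hdim : Module.finrank ℝ V = 3)
    (μ : V [⋀^Fin 3]→ₗ[ℝ] ℝ) (hμ : μ ≠ 0) (B : V) (η : V →ₗ[ℝ] ℝ) (hη : 0 < η B)
    (b : V →ₗ[ℝ] (V →ₗ[ℝ] ℝ))
    (hb : ∀ v w : V, b v w = μ ![B, v, w] + η v * η w) :
    ∀ (v : V) (α : V →ₗ[ℝ] ℝ),
      b v = α ↔
        ∀ w₁ w₂ : V,
          μ ![v, w₁, w₂] =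
            (α w₁ * η w₂ - η w₁ * α w₂) / η B + (α B / (η B) ^ 2) * μ ![B, w₁, w₂] := by
  have hid := four_id V hdim μ η B
  have hB : η B ≠ 0 := hη.ne'
  have hBB : ∀ w, μ ![B, B, w] = 0 := fun w =>
    μ.map_eq_zero_of_eq _ (i := 0) (j := 1) (by simp) (by decide)
  have hBwB : ∀ w, μ ![B, w, B] = 0 := fun w =>
    μ.map_eq_zero_of_eq _ (i := 0) (j := 2) (by simp) (by decide)
  intro v α
  constructor
  · rintro rfl w₁ w₂
    have h := hid v w₁ w₂
    rw [hb, hb, hb, hBwB]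
    field_simp
    linear_combination η B * h
  · intro h
    have hα : ∀ w, α w = μ ![B, v, w] + α B / η B * η w := by
      intro w
      have h1 := h B w
      have h2 := hid v B w
      rw [hBB, hBwB] at *
      field_simp at h1 ⊢
      apply mul_left_cancel₀ hB
      linear_combination h1 - η B * h2
    have hne : ∃ x y, μ ![B, x, y] ≠ 0 := by
      by_contra! hc
      apply hμ
      ext m
      have h3 := hid (m 0) (m 1) (m 2)
      rw [hc, hc, hc] at h3
      have : m = ![m 0, m 1, m 2] := by
        ext i; fin_cases i <;> rfl
      rw [this]
      simpa [hB] using h3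
    obtain ⟨x, y, hxy⟩ := hne
    have h1 := h x y
    rw [hα x, hα y] at h1
    have h2 := hid v x y
    have hv : α B / η B = η v := by
      field_simp at h1 ⊢
      apply mul_left_cancel₀ hxy
      linear_combination η B * h2 - h1
    ext w
    rw [hb, hα w, hv]
end

section
/- Let V be a real vector space with dim V = 3, let μ be a nonzero alternating 3-form on V, let B ∈ V, let η be a linear functional on V with η(B) > 0, and let ν be a linear functional on V with ν(B) = 0. Then there exists a unique u ∈ V such that μ(B, u, w) = ν(w) for all w ∈ V and η(u) = 0. -/
/-- Let `V` be a real vector space with `dim V = 3`, `μ` a nonzero alternating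
3-form on `V`, `B ∈ V`, `η` a linear functional with `η B > 0`, and `ν` a linear functional
with `ν B = 0`. Then there exists a unique `u ∈ V` such that `μ (B, u, w) = ν w` for all `w`
and `η u = 0`. -/
theorem stmt_2 (V : Type*) [AddCommGroup V] [Module ℝ V] [FiniteDimensional ℝ V]
    (hdim : Module.finrank ℝ V = 3)
    (μ : V [⋀^Fin 3]→ₗ[ℝ] ℝ) (hμ : μ ≠ 0) (B : V)
    (η : V →ₗ[ℝ] ℝ) (hη : 0 < η B)
    (ν : V →ₗ[ℝ] ℝ) (hν : ν B = 0) :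
    ∃! u : V, (∀ w : V, μ ![B, u, w] = ν w) ∧ η u = 0 := by
  classical
  have hr : Module.finrank ℝ (LinearMap.range η) = 1 := by
    have : LinearMap.range η = ⊤ := by
      refine LinearMap.range_eq_top.2 (LinearMap.surjective ?_)
      rintro rfl
      simp at hη
    rw [this]; simp
  have hk : Module.finrank ℝ (LinearMap.ker η) = 2 := by
    have := LinearMap.finrank_range_add_finrank_ker η
    omega
  let c := Module.finBasisOfFinrankEq ℝ (LinearMap.ker η) hk
  obtain ⟨e, he⟩ : ∃ e, e = (c 0 : V) := ⟨_, rfl⟩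
  obtain ⟨f, hf⟩ : ∃ f, f = (c 1 : V) := ⟨_, rfl⟩
  have hηe : η e = 0 := by rw [he]; exact (c 0).2
  have hηf : η f = 0 := by rw [hf]; exact (c 1).2
  have hli2 : LinearIndependent ℝ ![e, f] := by
    have h := c.linearIndependent.map' (LinearMap.ker η).subtype (Submodule.ker_subtype _)
    have heq : ![e, f] = (LinearMap.ker η).subtype ∘ c := by
      ext i
      fin_cases i <;> simp [he, hf]
    rw [heq]
    exact h
  have hli : LinearIndependent ℝ ![B, e, f] := by
    refine linearIndependent_finCons.2 ⟨hli2, fun h => ?_⟩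
    have hle : Submodule.span ℝ (Set.range ![e, f]) ≤ LinearMap.ker η := by
      rw [Submodule.span_le]
      rintro _ ⟨i, rfl⟩
      fin_cases i <;> simp [hηe, hηf]
    have := hle h
    rw [LinearMap.mem_ker] at this
    linarith
  let b := basisOfLinearIndependentOfCardEqFinrank hli (by simp [hdim])
  have hb : (b : Fin 3 → V) = ![B, e, f] := by simp [b]
  have hm : μ ![B, e, f] ≠ 0 := by
    rw [← hb]; exact (AlternatingMap.map_basis_ne_zero_iff b μ).2 hμ
  have hdec : ∀ w : V, ∃ x y z : ℝ, w = x • B + y • e + z • f := by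
    intro w
    refine ⟨b.repr w 0, b.repr w 1, b.repr w 2, ?_⟩
    have := b.sum_repr w
    rw [Fin.sum_univ_three, hb] at this
    simpa using this.symm
  have hup : ∀ v w : V, Function.update ![B, 0, w] 1 v = ![B, v, w] := by
    intro v w
    ext i
    fin_cases i <;> simp [Function.update]
  have add1 : ∀ u v w, μ ![B, u + v, w] = μ ![B, u, w] + μ ![B, v, w] := by
    intro u v w
    have := μ.map_update_add ![B, 0, w] 1 u v
    rwa [hup, hup, hup] at this
  have hsw : ∀ u w, μ ![B, u, w] = - μ ![B, w, u] := by
    intro u w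
    have := μ.map_swap ![B, w, u] (i := 1) (j := 2) (by decide)
    rw [← this]
    congr 1
    ext i
    fin_cases i <;> simp [Equiv.swap_apply_def]
  have smul1 : ∀ (r : ℝ) u w, μ ![B, r • u, w] = r * μ ![B, u, w] := by
    intro r u w
    have := μ.map_update_smul ![B, 0, w] 1 r u
    rwa [hup, hup, smul_eq_mul] at this
  have hBB : ∀ w, μ ![B, B, w] = 0 := fun w =>
    μ.map_eq_zero_of_eq _ (i := 0) (j := 1) (by simp) (by decide)
  have huu : ∀ w, μ ![B, w, w] = 0 := fun w => by linarith [hsw w w]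
  have key : ∀ a x y a' x' y' : ℝ,
      μ ![B, a • B + x • e + y • f, a' • B + x' • e + y' • f]
        = (x * y' - y * x') * μ ![B, e, f] := by
    intro a x y a' x' y'
    have h1 : ∀ w, μ ![B, a • B + x • e + y • f, w] = x * μ ![B, e, w] + y * μ ![B, f, w] := by
      intro w
      rw [add1, add1, smul1, smul1, smul1, hBB]; ring
    have h2 : ∀ w, μ ![B, a' • B + x' • e + y' • f, w]
        = x' * μ ![B, e, w] + y' * μ ![B, f, w] := by
      intro w
      rw [add1, add1, smul1, smul1, smul1, hBB]; ring
    rw [h1, hsw e, hsw f, h2, h2, huu, huu, hsw f e]; ring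
  refine ⟨(0 : ℝ) • B + (ν f / μ ![B, e, f]) • e + (-(ν e / μ ![B, e, f])) • f, ⟨?_, ?_⟩, ?_⟩
  · intro w
    obtain ⟨x, y, z, rfl⟩ := hdec w
    rw [key]
    simp only [map_add, map_smul, hν, smul_eq_mul]
    field_simp
    ring
  · simp [hηe, hηf]
  · rintro u ⟨hu, hu0⟩
    obtain ⟨x, y, z, rfl⟩ := hdec u
    have hx : x = 0 := by
      simp only [map_add, map_smul, hηe, hηf, smul_eq_mul] at hu0
      have : x * η B = 0 := by linarith
      exact (mul_eq_zero.1 this).resolve_right hη.ne'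
    have h1 := key x y z 0 0 1
    have h2 := key x y z 0 1 0
    rw [hu] at h1 h2
    simp only [zero_smul, one_smul, zero_add, add_zero] at h1 h2
    have hy : y = ν f / μ ![B, e, f] := by
      rw [h1]; field_simp; ring
    have hz : z = -(ν e / μ ![B, e, f]) := by
      rw [h2]; field_simp; ring
    rw [← hy, ← hz, hx]
end

section
/- Let V be a real vector space with dim V = 3, let σ be an alternating 2-form on V, and let e be a linear functional on V. Define the bilinear form Ω on V × ℝ by Ω (w, s) (w', s') = σ(w, w') + s·e(w') − s'·e(w). Then Ω is nondegenerate (i.e., if Ω (w,s) (w',s') = 0 for all (w',s') then (w,s) = (0,0)) if and only if the alternating 3-form σ∧e : (v₁,v₂,v₃) ↦ σ(v₁,v₂)·e(v₃) − σ(v₁,v₃)·e(v₂) + σ(v₂,v₃)·e(v₁) is nonzero. -/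
/-- Let `V` be real with `dim V = 3`, `σ` an alternating 2-form on `V`, `e` a
linear functional. The bilinear form `Ω ((w,s),(w',s')) = σ(w,w') + s·e(w') − s'·e(w)` on
`V × ℝ` is nondegenerate iff the alternating 3-form `σ ∧ e` is nonzero. -/
theorem stmt_10 (V : Type*) [AddCommGroup V] [Module ℝ V] [FiniteDimensional ℝ V]
    (hdim : Module.finrank ℝ V = 3)
    (σ : V [⋀^Fin 2]→ₗ[ℝ] ℝ) (e : V →ₗ[ℝ] ℝ)
    (Ω : (V × ℝ) →ₗ[ℝ] (V × ℝ) →ₗ[ℝ] ℝ)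
    (hΩ : ∀ (w : V) (s : ℝ) (w' : V) (s' : ℝ),
      Ω (w, s) (w', s') = σ ![w, w'] + s * e w' - s' * e w)
    (τ : V [⋀^Fin 3]→ₗ[ℝ] ℝ)
    (hτ : ∀ v₁ v₂ v₃ : V,
      τ ![v₁, v₂, v₃] = σ ![v₁, v₂] * e v₃ - σ ![v₁, v₃] * e v₂ + σ ![v₂, v₃] * e v₁) :
    (∀ p : V × ℝ, (∀ q : V × ℝ, Ω p q = 0) → p = 0) ↔ τ ≠ 0 := by
  classical
  obtain ⟨B, hB⟩ : ∃ B : V →ₗ[ℝ] V →ₗ[ℝ] ℝ, ∀ w w', σ ![w, w'] = B w w' :=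
    ⟨Ω.compl₁₂ (LinearMap.inl ℝ V ℝ) (LinearMap.inl ℝ V ℝ), fun w w' => by simp [hΩ]⟩
  have hBs : ∀ w, B w w = 0 := fun w => by
    rw [← hB]
    exact σ.map_eq_zero_of_eq ![w, w] (i := 0) (j := 1) rfl (by decide)
  have hBa : ∀ w w', B w w' = - B w' w := fun w w' => by
    have h := hBs (w + w')
    simp only [map_add, LinearMap.add_apply, hBs] at h
    linarith
  simp only [hB] at hΩ hτ
  let b : Module.Basis (Fin 3) ℝ V := Module.finBasisOfFinrankEq ℝ V hdim
  have hexp : ∀ w : V, ∃ p q r : ℝ, w = p • b 0 + q • b 1 + r • b 2 := fun w =>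
    ⟨b.repr w 0, b.repr w 1, b.repr w 2, by
      conv_lhs => rw [← b.sum_repr w, Fin.sum_univ_three]⟩
  have hind : ∀ p q r : ℝ, p • b 0 + q • b 1 + r • b 2 = 0 → p = 0 ∧ q = 0 ∧ r = 0 := by
    intro p q r h
    have h1 := Fintype.linearIndependent_iff.mp b.linearIndependent ![p, q, r]
      (by simpa [Fin.sum_univ_three] using h)
    exact ⟨h1 0, h1 1, h1 2⟩
  generalize b 0 = b0 at hexp hind
  generalize b 1 = b1 at hexp hind
  generalize b 2 = b2 at hexp hind
  have e10 := hBa b1 b0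
  have e20 := hBa b2 b0
  have e21 := hBa b2 b1
  have key : ∀ p q r s p' q' r' s' : ℝ,
      Ω (p • b0 + q • b1 + r • b2, s) (p' • b0 + q' • b1 + r' • b2, s')
        = (p * q' - q * p') * B b0 b1 + (p * r' - r * p') * B b0 b2
          + (q * r' - r * q') * B b1 b2 + s * (p' * e b0 + q' * e b1 + r' * e b2)
          - s' * (p * e b0 + q * e b1 + r * e b2) := by
    intro p q r s p' q' r' s'
    rw [hΩ]
    simp only [map_add, map_smul, LinearMap.add_apply, LinearMap.smul_apply, hBs, e10, e20, e21,
      smul_eq_mul]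
    ring
  constructor
  · intro hnd h0
    have ht : B b0 b1 * e b2 - B b0 b2 * e b1 + B b1 b2 * e b0 = 0 := by
      rw [← hτ, h0]; rfl
    have hz : ∀ p q r s : ℝ, (∀ p' q' r' s' : ℝ,
        (p * q' - q * p') * B b0 b1 + (p * r' - r * p') * B b0 b2
          + (q * r' - r * q') * B b1 b2 + s * (p' * e b0 + q' * e b1 + r' * e b2)
          - s' * (p * e b0 + q * e b1 + r * e b2) = 0) → p = 0 ∧ q = 0 ∧ r = 0 ∧ s = 0 := by
      intro p q r s h
      have h1 := hnd (p • b0 + q • b1 + r • b2, s) (by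
        rintro ⟨w', s'⟩
        obtain ⟨p', q', r', rfl⟩ := hexp w'
        rw [key]; exact h _ _ _ _)
      rw [Prod.mk_eq_zero] at h1
      obtain ⟨h2, h3, h4⟩ := hind _ _ _ h1.1
      exact ⟨h2, h3, h4, h1.2⟩
    obtain ⟨d0, c0, a0, -⟩ := hz (B b1 b2) (-B b0 b2) (B b0 b1) 0 (by
      intro p' q' r' s'; linear_combination (-s') * ht)
    obtain ⟨y0, x0, -, -⟩ := hz (e b1) (-e b0) 0 (-B b0 b1) (by
      intro p' q' r' s'; linear_combination (-r') * ht)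
    obtain ⟨z0, -, -, -⟩ := hz (e b2) 0 (-e b0) (-B b0 b2) (by
      intro p' q' r' s'; linear_combination q' * ht)
    rw [neg_eq_zero] at c0 x0
    have := hz 0 0 0 1 (by intro p' q' r' s'; rw [x0, y0, z0]; ring)
    exact one_ne_zero this.2.2.2
  · intro hne
    have ht : B b0 b1 * e b2 - B b0 b2 * e b1 + B b1 b2 * e b0 ≠ 0 := by
      intro ht
      apply hne
      ext v
      have hv : v = ![v 0, v 1, v 2] := by ext i; fin_cases i <;> rfl
      rw [hv, hτ]
      obtain ⟨p, q, r, h0⟩ := hexp (v 0)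
      obtain ⟨p', q', r', h1⟩ := hexp (v 1)
      obtain ⟨p'', q'', r'', h2⟩ := hexp (v 2)
      rw [h0, h1, h2]
      simp only [map_add, map_smul, LinearMap.add_apply, LinearMap.smul_apply, hBs, e10, e20, e21,
        smul_eq_mul, AlternatingMap.zero_apply]
      linear_combination (p * (q' * r'' - r' * q'') - q * (p' * r'' - r' * p'')
        + r * (p' * q'' - q' * p'')) * ht
    rintro ⟨w, s⟩ h
    obtain ⟨p, q, r, rfl⟩ := hexp w
    have hk : ∀ p' q' r' s' : ℝ, _ = (0 : ℝ) := fun p' q' r' s' =>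
      (key p q r s p' q' r' s').symm.trans (h _)
    have k0 := hk 1 0 0 0
    have k1 := hk 0 1 0 0
    have k2 := hk 0 0 1 0
    have k3 := hk 0 0 0 1
    have hp : p = 0 := by
      refine (mul_eq_zero.mp ?_).resolve_right ht
      linear_combination e b2 * k1 - e b1 * k2 - B b1 b2 * k3
    have hq : q = 0 := by
      refine (mul_eq_zero.mp ?_).resolve_right ht
      linear_combination -e b2 * k0 + e b0 * k2 + B b0 b2 * k3
    have hr : r = 0 := by
      refine (mul_eq_zero.mp ?_).resolve_right ht
      linear_combination e b1 * k0 - e b0 * k1 - B b0 b1 * k3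
    have hs : s = 0 := by
      refine (mul_eq_zero.mp ?_).resolve_right ht
      linear_combination B b1 b2 * k0 - B b0 b2 * k1 + B b0 b1 * k2
    simp [hp, hq, hr, hs]
end

section
/- Let h : ℝ × ℝ → ℝ be defined by h(x,y) = (x² + y² − 1)·(1 + y²·(x² + y² − 2)). Then for every (x,y) with x² + y² ≤ 2, both partial derivatives of h vanish at (x,y) (equivalently fderiv ℝ h (x,y) = 0) if and only if (x,y) = (0,0) or (x,y) = (0,1) or (x,y) = (0,−1). -/
/-- For `h(x,y) = (x²+y²−1)(1+y²(x²+y²−2))` and `(x,y)` in the closed disk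
`x² + y² ≤ 2`, both partial derivatives of `h` vanish at `(x,y)` iff `(x,y)` is one of
`(0,0)`, `(0,1)`, `(0,−1)`. -/
theorem stmt_11
    (h : ℝ × ℝ → ℝ)
    (hh : ∀ p : ℝ × ℝ, h p = (p.1 ^ 2 + p.2 ^ 2 - 1) * (1 + p.2 ^ 2 * (p.1 ^ 2 + p.2 ^ 2 - 2))) :
    ∀ x y : ℝ, x ^ 2 + y ^ 2 ≤ 2 →
      ((fderiv ℝ h (x, y) (1, 0) = 0 ∧ fderiv ℝ h (x, y) (0, 1) = 0) ↔
        ((x, y) = ((0 : ℝ), (0 : ℝ)) ∨ (x, y) = ((0 : ℝ), (1 : ℝ)) ∨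
          (x, y) = ((0 : ℝ), (-1 : ℝ)))) := by
  intro x y _
  have hf : h = fun p : ℝ × ℝ =>
      (p.1 ^ 2 + p.2 ^ 2 - 1) * (1 + p.2 ^ 2 * (p.1 ^ 2 + p.2 ^ 2 - 2)) := funext hh
  have h1 : HasFDerivAt (fun p : ℝ × ℝ => p.1 ^ 2) _ (x, y) :=
    (hasFDerivAt_fst (𝕜 := ℝ) (p := (x, y))).pow 2
  have h2 : HasFDerivAt (fun p : ℝ × ℝ => p.2 ^ 2) _ (x, y) :=
    (hasFDerivAt_snd (𝕜 := ℝ) (p := (x, y))).pow 2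
  have h3 : HasFDerivAt (fun p : ℝ × ℝ =>
      (p.1 ^ 2 + p.2 ^ 2 - 1) * (1 + p.2 ^ 2 * (p.1 ^ 2 + p.2 ^ 2 - 2))) _ (x, y) :=
    ((h1.add h2).sub_const 1).mul ((h2.mul ((h1.add h2).sub_const 2)).const_add 1)
  have hx : fderiv ℝ h (x, y) (1, 0) = 2 * x * (1 + y ^ 2 * (2 * (x ^ 2 + y ^ 2) - 3)) := by
    rw [hf, h3.fderiv]
    simp
    ring
  have hy : fderiv ℝ h (x, y) (0, 1) = 2 * y * (1 + y ^ 2 * (2 * (x ^ 2 + y ^ 2) - 3)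
      + (x ^ 2 + y ^ 2 - 1) * (x ^ 2 + y ^ 2 - 2)) := by
    rw [hf, h3.fderiv]
    simp
    ring
  rw [hx, hy]
  simp only [Prod.mk.injEq]
  constructor
  · rintro ⟨a, b⟩
    by_cases x0 : x = 0
    · subst x0
      by_cases y0 : y = 0
      · exact Or.inl ⟨rfl, y0⟩
      · right
        have e : (y * (y ^ 2 - 1) ^ 2) = 0 := by linear_combination b / 6
        have e2 : (y - 1) * (y + 1) = 0 := by
          have := pow_eq_zero_iff (two_ne_zero) |>.1 ((mul_eq_zero.1 e).resolve_left y0)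
          linear_combination this
        rcases mul_eq_zero.1 e2 with e | e
        · exact Or.inl ⟨rfl, by linarith⟩
        · exact Or.inr ⟨rfl, by linarith⟩
    · exfalso
      have A : 1 + y ^ 2 * (2 * (x ^ 2 + y ^ 2) - 3) = 0 :=
        (mul_eq_zero.1 a).resolve_left (by simpa using x0)
      have y0 : y ≠ 0 := by
        rintro rfl
        norm_num at A
      have B := (mul_eq_zero.1 b).resolve_left (by simpa using y0)
      rw [A, zero_add] at B
      rcases mul_eq_zero.1 B with e | e
      · apply x0
        have : x ^ 2 = 0 := by linear_combination (1 - 2 * y ^ 2) * e + A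
        exact pow_eq_zero_iff two_ne_zero |>.1 this
      · have : 1 + y ^ 2 = 0 := by linear_combination A - 2 * y ^ 2 * e
        nlinarith [sq_nonneg y]
  · rintro (⟨rfl, rfl⟩ | ⟨rfl, rfl⟩ | ⟨rfl, rfl⟩) <;> norm_num
end

section
/- Let h : ℝ × ℝ → ℝ be defined by h(x,y) = (x² + y² − 1)·(1 + y²·(x² + y² − 2)). Then for every (x,y) with x² + y² ≤ 2, one has h(x,y) = 0 if and only if x² + y² = 1. -/
/-- For `h(x,y) = (x²+y²−1)(1+y²(x²+y²−2))` and `(x,y)` in the closed disk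
`x² + y² ≤ 2`, one has `h(x,y) = 0` iff `x² + y² = 1`. -/
theorem stmt_12
    (h : ℝ × ℝ → ℝ)
    (hh : ∀ p : ℝ × ℝ, h p = (p.1 ^ 2 + p.2 ^ 2 - 1) * (1 + p.2 ^ 2 * (p.1 ^ 2 + p.2 ^ 2 - 2))) :
    ∀ x y : ℝ, x ^ 2 + y ^ 2 ≤ 2 → (h (x, y) = 0 ↔ x ^ 2 + y ^ 2 = 1) := by
  intro x y _
  rw [hh]
  constructor
  · intro h0
    rcases mul_eq_zero.mp h0 with h1 | h1
    · simp only at h1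
      linarith
    · simp only at h1
      have e : (y ^ 2 - 1) ^ 2 + (x * y) ^ 2 = 0 := by linear_combination h1
      have a : (y ^ 2 - 1) ^ 2 = 0 := by
        linarith [sq_nonneg (y ^ 2 - 1), sq_nonneg (x * y)]
      have b : (x * y) ^ 2 = 0 := by linarith
      have a2 : y ^ 2 - 1 = 0 := pow_eq_zero_iff (two_ne_zero) |>.mp a
      linear_combination b + (1 - x ^ 2) * a2
  · intro h1
    simp only
    rw [h1]
    ring
end

section
/- Let h : ℝ × ℝ → ℝ be defined by h(x,y) = (x² + y² − 1)·(1 + y²·(x² + y² − 2)). Then for every (x,y) with x² + y² ≤ 2, one has h(x,y) ≥ −1, and h(x,y) = −1 if and only if (x,y) = (0,0); that is, (0,0) is the unique global minimizer of h on the closed disk of radius √2, and the level set h⁻¹(−1) within this disk is {(0,0)}. -/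
/-- For `h(x,y) = (x²+y²−1)(1+y²(x²+y²−2))` and `(x,y)` in the closed disk
`x² + y² ≤ 2`, one has `h(x,y) ≥ −1`, with equality iff `(x,y) = (0,0)`. -/
theorem stmt_13
    (h : ℝ × ℝ → ℝ)
    (hh : ∀ p : ℝ × ℝ, h p = (p.1 ^ 2 + p.2 ^ 2 - 1) * (1 + p.2 ^ 2 * (p.1 ^ 2 + p.2 ^ 2 - 2))) :
    ∀ x y : ℝ, x ^ 2 + y ^ 2 ≤ 2 →
      (-1 ≤ h (x, y) ∧ (h (x, y) = -1 ↔ (x, y) = ((0 : ℝ), (0 : ℝ)))) := by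
  intro x y _
  have key : h (x, y) + 1 = 3 / 4 * (x ^ 2 + y ^ 2) + x ^ 2 / 4
      + (y * (x ^ 2 + y ^ 2 - 3 / 2)) ^ 2 := by
    rw [hh]; ring
  have h1 := sq_nonneg x
  have h2 := sq_nonneg y
  have h3 := sq_nonneg (y * (x ^ 2 + y ^ 2 - 3 / 2))
  refine ⟨by linarith, fun he => ?_, fun he => ?_⟩
  · have hx : x ^ 2 = 0 := by linarith
    have hy : y ^ 2 = 0 := by linarith
    rw [pow_eq_zero_iff two_ne_zero] at hx hy
    rw [hx, hy]
  · rw [he, hh]; norm_num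
end

section
/- Let h : ℝ × ℝ → ℝ be defined by h(x,y) = (x² + y² − 1)·(1 + y²·(x² + y² − 2)). Then for every z ∈ ℝ, the set {(x,y) : x² + y² ≤ 2 ∧ h(x,y) = z} is preconnected; that is, every level set of h within the closed disk of radius √2 is connected (or empty). -/
theorem aux_mono {q a b : ℝ} (h0 : 0 ≤ q) (h1 : q ≤ 1) (hab : a < b) :
    (1 - q) * a + q * a ^ 3 < (1 - q) * b + q * b ^ 3 := by
  have h3 : a ^ 3 < b ^ 3 := (Odd.strictMono_pow (by decide : Odd 3)) hab
  rcases h0.eq_or_lt with h | h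
  · subst h; linarith
  · nlinarith [mul_lt_mul_of_pos_left h3 h, mul_le_mul_of_nonneg_left hab.le (sub_nonneg.2 h1)]

/-- For `h(x,y) = (x²+y²−1)(1+y²(x²+y²−2))`, every level set of `h` within
the closed disk `x² + y² ≤ 2` is preconnected. -/
theorem stmt_14
    (h : ℝ × ℝ → ℝ)
    (hh : ∀ p : ℝ × ℝ, h p = (p.1 ^ 2 + p.2 ^ 2 - 1) * (1 + p.2 ^ 2 * (p.1 ^ 2 + p.2 ^ 2 - 2))) :
    ∀ z : ℝ, IsPreconnected {p : ℝ × ℝ | p.1 ^ 2 + p.2 ^ 2 ≤ 2 ∧ h p = z} := by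
  intro z
  have q0 : ∀ t : ℝ, 0 ≤ Real.sin t ^ 2 := fun t => sq_nonneg _
  have q1 : ∀ t : ℝ, Real.sin t ^ 2 ≤ 1 := fun t => Real.sin_sq_le_one t
  -- polar form of points of the level set
  have polar : ∀ p : ℝ × ℝ, p.1 ^ 2 + p.2 ^ 2 ≤ 2 → h p = z → ∃ t u : ℝ,
      -1 ≤ u ∧ u ≤ 1 ∧ (1 - Real.sin t ^ 2) * u + Real.sin t ^ 2 * u ^ 3 = z ∧
      p = (√(1 + u) * Real.cos t, √(1 + u) * Real.sin t) := by
    rintro ⟨x, y⟩ h2 hz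
    rw [hh] at hz
    simp only at h2 hz
    have hx := Complex.norm_mul_cos_arg (⟨x, y⟩ : ℂ)
    have hy := Complex.norm_mul_sin_arg (⟨x, y⟩ : ℂ)
    have hr : ‖(⟨x, y⟩ : ℂ)‖ = √(1 + (x ^ 2 + y ^ 2 - 1)) := by
      rw [Complex.norm_def, Complex.normSq_mk]; congr 1; ring
    simp only [hr] at hx hy
    refine ⟨Complex.arg ⟨x, y⟩, x ^ 2 + y ^ 2 - 1, by nlinarith, by linarith, ?_, ?_⟩
    · have hy2 : (x ^ 2 + y ^ 2) * Real.sin (Complex.arg ⟨x, y⟩) ^ 2 = y ^ 2 := by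
        conv_rhs => rw [← hy]
        rw [mul_pow, Real.sq_sqrt (by nlinarith)]; ring
      rw [← hz]
      linear_combination (x ^ 2 + y ^ 2 - 1) * (x ^ 2 + y ^ 2 - 2) * hy2
    · rw [hx, hy]
  by_cases hzz : -1 ≤ z ∧ z ≤ 1
  swap
  · convert isPreconnected_empty
    rw [Set.eq_empty_iff_forall_notMem]
    rintro p ⟨h2, hz⟩
    obtain ⟨t, u, hu1, hu2, e, -⟩ := polar p h2 hz
    apply hzz
    have hu3 : u ^ 3 ≤ 1 := by nlinarith [sq_nonneg (u + 1), sq_nonneg u]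
    have hu4 : -1 ≤ u ^ 3 := by nlinarith [sq_nonneg (u - 1), sq_nonneg u]
    constructor <;> nlinarith [q0 t, q1 t, mul_nonneg (q0 t) (sub_nonneg.2 hu3),
      mul_nonneg (q0 t) (sub_nonneg.2 hu4), mul_nonneg (sub_nonneg.2 (q1 t)) (sub_nonneg.2 hu1),
      mul_nonneg (sub_nonneg.2 (q1 t)) (sub_nonneg.2 hu2)]
  · have ex : ∀ t : ℝ, ∃ u : ℝ, u ∈ Set.Icc (-1 : ℝ) 1 ∧
        (1 - Real.sin t ^ 2) * u + Real.sin t ^ 2 * u ^ 3 = z := by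
      intro t
      have := intermediate_value_Icc (f := fun u : ℝ =>
        (1 - Real.sin t ^ 2) * u + Real.sin t ^ 2 * u ^ 3) (by norm_num : (-1 : ℝ) ≤ 1)
        (by fun_prop)
      exact this ⟨by linarith [hzz.1], by linarith [hzz.2]⟩
    choose u hu e using ex
    have mono : ∀ t a b : ℝ, a < b → _ := fun t a b hab => aux_mono (q0 t) (q1 t) hab
    have smono : ∀ t : ℝ, StrictMono
        (fun u : ℝ => (1 - Real.sin t ^ 2) * u + Real.sin t ^ 2 * u ^ 3) :=
      fun t a b hab => aux_mono (q0 t) (q1 t) hab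
    have hc : Continuous u := by
      rw [continuous_iff_continuousAt]
      intro t
      refine tendsto_order.2 ⟨fun a ha => ?_, fun a ha => ?_⟩
      · have hlt := mono t _ _ ha
        rw [e t] at hlt
        have hcc : Continuous fun s : ℝ => (1 - Real.sin s ^ 2) * a + Real.sin s ^ 2 * a ^ 3 := by
          fun_prop
        filter_upwards [hcc.continuousAt.eventually_lt_const hlt] with s hs
        rw [← e s] at hs
        exact (smono s).lt_iff_lt.1 hs
      · have hlt := mono t _ _ ha
        rw [e t] at hlt
        have hcc : Continuous fun s : ℝ => (1 - Real.sin s ^ 2) * a + Real.sin s ^ 2 * a ^ 3 := by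
          fun_prop
        filter_upwards [hcc.continuousAt.eventually_const_lt hlt] with s hs
        rw [← e s] at hs
        exact (smono s).lt_iff_lt.1 hs
    have hF : Continuous fun t : ℝ => (√(1 + u t) * Real.cos t, √(1 + u t) * Real.sin t) := by
      fun_prop
    convert isPreconnected_range hF
    ext p
    constructor
    · rintro ⟨h2, hz⟩
      obtain ⟨t, v, -, -, ev, hp⟩ := polar p h2 hz
      have : u t = v := (smono t).injective ((e t).trans ev.symm)
      exact ⟨t, by simp only [this, hp]⟩
    · rintro ⟨t, rfl⟩
      have hs : √(1 + u t) ^ 2 = 1 + u t := Real.sq_sqrt (by linarith [(hu t).1])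
      have hr : (√(1 + u t) * Real.cos t) ^ 2 + (√(1 + u t) * Real.sin t) ^ 2 = 1 + u t := by
        rw [mul_pow, mul_pow, hs]
        linear_combination (1 + u t) * Real.sin_sq_add_cos_sq t
      refine ⟨?_, ?_⟩
      · simp only [hr]; linarith [(hu t).2]
      · rw [hh]
        simp only [hr]
        rw [mul_pow, hs, ← e t]
        ring
end

section
/- Let h : ℝ × ℝ → ℝ be defined by h(x,y) = (x² + y² − 1)·(1 + y²·(x² + y² − 2)). Then for every (x,y) with x² + y² = 1, the partial derivatives of h satisfy ∂ₓh(x,y) = 2x³ and ∂_yh(x,y) = 2x²·y; equivalently, the gradient of h at any point of the unit circle equals 2x² • (x, y). In particular, the unit circle is contained in a level set of h and the Hamiltonian vector field (−∂_yh, ∂ₓh) is tangent to it, with x-independent sign of its y-component governed by 2x³. -/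
/-- For `h(x,y) = (x²+y²−1)(1+y²(x²+y²−2))` and any `(x,y)` on the unit
circle `x² + y² = 1`, the partial derivatives satisfy `∂ₓh(x,y) = 2x³` and
`∂_yh(x,y) = 2x²y`; i.e. the gradient at any point of the unit circle is `2x² • (x, y)`. -/
theorem stmt_15
    (h : ℝ × ℝ → ℝ)
    (hh : ∀ p : ℝ × ℝ, h p = (p.1 ^ 2 + p.2 ^ 2 - 1) * (1 + p.2 ^ 2 * (p.1 ^ 2 + p.2 ^ 2 - 2))) :
    ∀ x y : ℝ, x ^ 2 + y ^ 2 = 1 →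
      fderiv ℝ h (x, y) (1, 0) = 2 * x ^ 3 ∧
        fderiv ℝ h (x, y) (0, 1) = 2 * x ^ 2 * y := by
  intro x y hxy
  have e : h = fun p : ℝ × ℝ =>
      (p.1 ^ 2 + p.2 ^ 2 - 1) * (1 + p.2 ^ 2 * (p.1 ^ 2 + p.2 ^ 2 - 2)) := funext hh
  have h1 : HasFDerivAt (fun p : ℝ × ℝ => p.1) (ContinuousLinearMap.fst ℝ ℝ ℝ) (x, y) :=
    hasFDerivAt_fst
  have h2 : HasFDerivAt (fun p : ℝ × ℝ => p.2) (ContinuousLinearMap.snd ℝ ℝ ℝ) (x, y) :=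
    hasFDerivAt_snd
  have h3 := (h1.pow 2).add (h2.pow 2)
  have H := (h3.sub_const 1).mul (((h2.pow 2).mul (h3.sub_const 2)).const_add 1)
  have e2 := H.congr_of_eventuallyEq (f₁ := h) (Filter.Eventually.of_forall fun p => by
    simp [e])
  have hx : x ^ 2 = 1 - y ^ 2 := by linarith
  rw [e2.fderiv]
  constructor
  · simp [hxy]
    linear_combination (-2 * x) * hxy
  · simp [hxy]
    linear_combination (-2 * y) * hxy
end

section
/- Let h : ℝ × ℝ → ℝ be defined by h(x,y) = (x² + y² − 1)·(1 + y²·(x² + y² − 2)) and let f : ℝ × ℝ → ℝ be f(x,y) = y + x² + y² − 1. Then for every (x,y) with x² + y² ≤ 2, if both partial derivatives of h vanish at (x,y), then f(x,y) ≠ 0. Consequently, the vector field B = (−∂_yh, ∂ₓh, f) on the solid torus (disk of radius √2) × (ℝ/ℤ) has no zeros. -/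
/-- For `h(x,y) = (x²+y²−1)(1+y²(x²+y²−2))` and `f(x,y) = y + x² + y² − 1`,
at every point of the closed disk `x² + y² ≤ 2` where both partial derivatives of `h`
vanish, `f` is nonzero; consequently the vector field `B = (−∂_yh, ∂ₓh, f)` on the solid
torus has no zeros. -/
theorem stmt_16
    (h : ℝ × ℝ → ℝ)
    (hh : ∀ p : ℝ × ℝ, h p = (p.1 ^ 2 + p.2 ^ 2 - 1) * (1 + p.2 ^ 2 * (p.1 ^ 2 + p.2 ^ 2 - 2)))
    (f : ℝ × ℝ → ℝ)
    (hf : ∀ p : ℝ × ℝ, f p = p.2 + p.1 ^ 2 + p.2 ^ 2 - 1) :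
    (∀ x y : ℝ, x ^ 2 + y ^ 2 ≤ 2 →
        (fderiv ℝ h (x, y) (1, 0) = 0 ∧ fderiv ℝ h (x, y) (0, 1) = 0) → f (x, y) ≠ 0) ∧
      ∀ x y : ℝ, x ^ 2 + y ^ 2 ≤ 2 →
        (-(fderiv ℝ h (x, y) (0, 1)), fderiv ℝ h (x, y) (1, 0), f (x, y)) ≠
          ((0 : ℝ), (0 : ℝ), (0 : ℝ)) := by
  have key : ∀ x y : ℝ, fderiv ℝ h (x, y) (1, 0) = 2 * x * (1 + y ^ 2 * (2 * (x ^ 2 + y ^ 2) - 3)) ∧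
      fderiv ℝ h (x, y) (0, 1) = 2 * y * (1 + y ^ 2 * (2 * (x ^ 2 + y ^ 2) - 3)) +
        2 * y * (x ^ 2 + y ^ 2 - 1) * (x ^ 2 + y ^ 2 - 2) := by
    intro x y
    have h1 : HasFDerivAt (fun p : ℝ × ℝ => p.1) (ContinuousLinearMap.fst ℝ ℝ ℝ) (x, y) :=
      hasFDerivAt_fst
    have h2 : HasFDerivAt (fun p : ℝ × ℝ => p.2) (ContinuousLinearMap.snd ℝ ℝ ℝ) (x, y) :=
      hasFDerivAt_snd
    have hs := (h1.pow 2).add (h2.pow 2)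
    have hd := (hs.sub_const 1).mul (((h2.pow 2).mul (hs.sub_const 2)).const_add 1)
    have he : HasFDerivAt h _ (x, y) := hd.congr_of_eventuallyEq
      (Filter.Eventually.of_forall fun p => by simp [hh])
    rw [he.fderiv]
    constructor
    · simp
      ring
    · simp
      ring
  have main : ∀ x y : ℝ, x ^ 2 + y ^ 2 ≤ 2 →
        (fderiv ℝ h (x, y) (1, 0) = 0 ∧ fderiv ℝ h (x, y) (0, 1) = 0) → f (x, y) ≠ 0 := by
    rintro x y - ⟨hx, hy⟩ h0
    rw [(key x y).1] at hx
    rw [(key x y).2] at hy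
    rw [hf] at h0
    simp only at h0
    rcases mul_eq_zero.mp hx with hx | hb
    · have hx0 : x = 0 := by linarith
      subst hx0
      have h3 : y * (y ^ 2 - 1) ^ 2 = 0 := by linear_combination hy / 6
      rcases mul_eq_zero.mp h3 with h4 | h4
      · subst h4
        norm_num at h0
      · have h5 : y ^ 2 - 1 = 0 := by simpa using h4
        have h6 : y = 0 := by linear_combination h0 - h5
        subst h6
        norm_num at h5
    · rw [hb] at hy
      have h3 : y * ((x ^ 2 + y ^ 2 - 1) * (x ^ 2 + y ^ 2 - 2)) = 0 := by
        linear_combination hy / 2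
      rcases mul_eq_zero.mp h3 with h4 | h4
      · subst h4
        norm_num at hb
      · rcases mul_eq_zero.mp h4 with h5 | h5
        · have h6 : y = 0 := by linear_combination h0 - h5
          subst h6
          norm_num at hb
        · have h6 : 1 + y ^ 2 = 0 := by linear_combination hb - 2 * y ^ 2 * h5
          nlinarith [sq_nonneg y]
  refine ⟨main, fun x y hxy hB => ?_⟩
  simp only [Prod.mk.injEq, neg_eq_zero] at hB
  exact main x y hxy ⟨hB.2.1, hB.1⟩ hB.2.2
end
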